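/- arXiv:1409.7957 — 2 statements merged into one kernel-verified Lean document; each statement's English description precedes it below -/
import Mathlib

section
/- Define Laurent polynomials Q_n, R_n in y over ℂ[u^{−1}] recursively by Q_0 = 1, R_0 = 0, Q_{n+1} = u^{−2} y³ ∂_y Q_n + y^{−2} R_n, and R_{n+1} = Q_n + u^{−2} y³ ∂_y R_n. Then for every n ≥ 0, both Q_n and R_n are even as functions of y and contain only nonpositive powers of y; that is, Q_n and R_n are polynomials in y^{−2} with coefficients in ℂ[u^{−1}]. -/
noncomputable section

/-- The base field `K = ℂ(u)`, rational functions in the variable `u`. -/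
abbrev K : Type := RatFunc ℂ

/-- The variable `u ∈ K`. -/
def u : K := RatFunc.X

/-- The formal derivative `∂_y` of a formal Laurent series in `y` over `K`. -/
def derivLS (f : LaurentSeries K) : LaurentSeries K where
  coeff := fun n => ((n + 1 : ℤ) : K) * f.coeff (n + 1)
  isPWO_support' := by
    refine ((f.isPWO_support.add (Set.isPWO_singleton (-1 : ℤ))).mono ?_)
    intro n hn
    simp only [Function.mem_support, ne_eq] at hn
    have hf : f.coeff (n + 1) ≠ 0 := fun h => hn (by simp [h])
    rw [Set.add_singleton]
    exact ⟨n + 1, by simpa [HahnSeries.mem_support] using hf, by ring⟩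

/-- Multiplication of a formal Laurent series by `y^k`. -/
def ySh (k : ℤ) (f : LaurentSeries K) : LaurentSeries K :=
  (HahnSeries.single k (1 : K)) * f

/-- The operator `S_y f = u⁻² y³ ∂_y f + (1/2) u⁻² y² f + y⁻¹ f`. -/
def Sy (f : LaurentSeries K) : LaurentSeries K :=
  (u⁻¹ ^ 2) • ySh 3 (derivLS f) + ((1 / 2 : K) * u⁻¹ ^ 2) • ySh 2 f + ySh (-1) f

/-- `a_n = (-1)^n (6n)! / (288^n (2n)! (3n)!)`. -/
def aQ (n : ℕ) : ℚ :=
  (-1) ^ n * ((6 * n).factorial : ℚ) /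
    (288 ^ n * ((2 * n).factorial : ℚ) * ((3 * n).factorial : ℚ))

/-- The power-series-in-`y` `Σ_{n ≥ 0} c_n u^{-2n} y^{3n}` (viewed as a Laurent series)
attached to rational coefficients `c : ℕ → ℚ`. -/
def mkS (c : ℕ → ℚ) : LaurentSeries K :=
  HahnSeries.ofPowerSeries ℤ K
    (PowerSeries.mk fun m => if 3 ∣ m then ((c (m / 3) : ℚ) : K) * u⁻¹ ^ (2 * (m / 3)) else 0)

/-- The series `A = Σ_{n ≥ 0} a_n u^{-2n} y^{3n}`. -/
def A : LaurentSeries K := mkS aQ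

/-- The pairs `(Q_n, R_n)` defined recursively by `Q_0 = 1`, `R_0 = 0`,
`Q_{n+1} = u⁻² y³ ∂_y Q_n + y⁻² R_n`, `R_{n+1} = Q_n + u⁻² y³ ∂_y R_n`. -/
def QR : ℕ → LaurentSeries K × LaurentSeries K
  | 0 => (1, 0)
  | n + 1 =>
    ((u⁻¹ ^ 2) • ySh 3 (derivLS (QR n).1) + ySh (-2) (QR n).2,
     (QR n).1 + (u⁻¹ ^ 2) • ySh 3 (derivLS (QR n).2))

/-- A Laurent series in `y` that is a polynomial in `y⁻²` with coefficients in `ℂ[u⁻¹]`. -/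
def IsEvenPoly (f : LaurentSeries K) : Prop :=
  f.support.Finite ∧
    (∀ m : ℤ, f.coeff m ≠ 0 → ∃ j : ℕ, m = -(2 * (j : ℤ))) ∧
    (∀ m : ℤ, f.coeff m ∈ Algebra.adjoin ℂ ({u⁻¹} : Set K))

theorem coeff_ySh (k : ℤ) (f : LaurentSeries K) (m : ℤ) :
    (ySh k f).coeff m = f.coeff (m - k) := by
  simp [ySh, HahnSeries.coeff_single_mul]

theorem coeff_smul_ySh_derivLS (f : LaurentSeries K) (m : ℤ) :
    ((u⁻¹ ^ 2) • ySh 3 (derivLS f)).coeff m =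
      u⁻¹ ^ 2 * (((m - 2 : ℤ) : K) * f.coeff (m - 2)) := by
  rw [HahnSeries.coeff_smul, coeff_ySh, smul_eq_mul]
  simp only [derivLS]
  rw [show m - 3 + 1 = m - 2 by ring]

theorem isEvenPoly_zero : IsEvenPoly 0 :=
  ⟨by simp, fun m hm => absurd (HahnSeries.coeff_zero (a := m)) hm,
    fun m => by simp [zero_mem]⟩

theorem isEvenPoly_one : IsEvenPoly 1 := by
  refine ⟨by simp, fun m hm => ⟨0, ?_⟩, fun m => ?_⟩
  · by_contra h
    exact hm (by simpa [HahnSeries.coeff_one] using h)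
  · rw [HahnSeries.coeff_one]
    split_ifs
    exacts [one_mem _, zero_mem _]

theorem IsEvenPoly.add {f g : LaurentSeries K} (hf : IsEvenPoly f) (hg : IsEvenPoly g) :
    IsEvenPoly (f + g) := by
  refine ⟨(hf.1.union hg.1).subset (HahnSeries.support_add_subset ..), fun m hm => ?_, fun m => ?_⟩
  · by_cases h : f.coeff m = 0
    · exact hg.2.1 m fun h' => hm (by simp [h, h'])
    · exact hf.2.1 m h
  · rw [HahnSeries.coeff_add]
    exact add_mem (hf.2.2 m) (hg.2.2 m)

theorem IsEvenPoly.ySh_neg_two {f : LaurentSeries K} (hf : IsEvenPoly f) :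
    IsEvenPoly (ySh (-2) f) := by
  refine ⟨(hf.1.image fun m => m - 2).subset fun m hm => ?_, fun m hm => ?_, fun m => ?_⟩
  · rw [HahnSeries.mem_support, coeff_ySh] at hm
    exact ⟨m - -2, hm, by ring⟩
  · rw [coeff_ySh] at hm
    obtain ⟨j, hj⟩ := hf.2.1 _ hm
    exact ⟨j + 1, by push_cast; linarith⟩
  · rw [coeff_ySh]
    exact hf.2.2 _

/-- The constant term is killed by `∂_y`, so no positive power of `y` appears. -/
theorem IsEvenPoly.smul_ySh_derivLS {f : LaurentSeries K} (hf : IsEvenPoly f) :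
    IsEvenPoly ((u⁻¹ ^ 2) • ySh 3 (derivLS f)) := by
  refine ⟨(hf.1.image fun m => m + 2).subset fun m hm => ?_, fun m hm => ?_, fun m => ?_⟩
  · rw [HahnSeries.mem_support, coeff_smul_ySh_derivLS] at hm
    exact ⟨m - 2, right_ne_zero_of_mul (right_ne_zero_of_mul hm), by ring⟩
  · rw [coeff_smul_ySh_derivLS] at hm
    have hm' := right_ne_zero_of_mul hm
    obtain ⟨j, hj⟩ := hf.2.1 _ (right_ne_zero_of_mul hm')
    have hne : m - 2 ≠ 0 := fun h => left_ne_zero_of_mul hm' (by rw [h, Int.cast_zero])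
    exact ⟨j - 1, by lia⟩
  · rw [coeff_smul_ySh_derivLS]
    exact mul_mem (pow_mem (Algebra.self_mem_adjoin_singleton ℂ _) 2)
      (mul_mem (intCast_mem _ _) (hf.2.2 _))

theorem isEvenPoly_QR (n : ℕ) : IsEvenPoly (QR n).1 ∧ IsEvenPoly (QR n).2 := by
  induction n with
  | zero => exact ⟨isEvenPoly_one, isEvenPoly_zero⟩
  | succ n ih =>
    exact ⟨ih.1.smul_ySh_derivLS.add ih.2.ySh_neg_two, ih.1.add ih.2.smul_ySh_derivLS⟩

/-- For every `n`, both `Q_n` and `R_n` are Laurent polynomials in `y` which are even and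
contain only nonpositive powers of `y`, with coefficients in `ℂ[u⁻¹]`; i.e. they are
polynomials in `y⁻²` with coefficients in `ℂ[u⁻¹] = Algebra.adjoin ℂ {u⁻¹}`. -/
theorem stmt7 (n : ℕ) :
    ((QR n).1.support.Finite ∧
      (∀ m : ℤ, (QR n).1.coeff m ≠ 0 → ∃ j : ℕ, m = -(2 * (j : ℤ))) ∧
      (∀ m : ℤ, (QR n).1.coeff m ∈ Algebra.adjoin ℂ ({u⁻¹} : Set K))) ∧
    ((QR n).2.support.Finite ∧
      (∀ m : ℤ, (QR n).2.coeff m ≠ 0 → ∃ j : ℕ, m = -(2 * (j : ℤ))) ∧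
      (∀ m : ℤ, (QR n).2.coeff m ∈ Algebra.adjoin ℂ ({u⁻¹} : Set K))) :=
  isEvenPoly_QR n

end
end

section
/- The identity A(y) · B(−y) + A(−y) · B(y) = 2 holds in K[[y]], where B := y · S_y A is written as B = Σ_{n≥0} b_n u^{−2n} y^{3n}, and A(−y) := Σ_{n≥0} (−1)^n a_n u^{−2n} y^{3n}, B(−y) := Σ_{n≥0} (−1)^n b_n u^{−2n} y^{3n}. -/
noncomputable section

/-- The series `B := y · S_y A`; it is a power series in `y` supported on powers `y^{3n}`
with constant term `1`. -/
def B : LaurentSeries K := ySh 1 (Sy A)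

/-- The substitution `y ↦ -y` on formal Laurent series: the coefficient of `y^m` is
multiplied by `(-1)^m`.  For a series supported on powers `y^{3n}` (such as `A` and `B`,
written as `Σ_{n≥0} c_n u^{-2n} y^{3n}`) this produces `Σ_{n≥0} (-1)^n c_n u^{-2n} y^{3n}`,
since `(-1)^{3n} = (-1)^n`. -/
def negSub (f : LaurentSeries K) : LaurentSeries K where
  coeff := fun m => (-1 : K) ^ m * f.coeff m
  isPWO_support' := by
    refine f.isPWO_support'.mono fun m hm => ?_
    simp only [Function.mem_support, ne_eq] at hm ⊢
    intro h
    exact hm (by simp [h])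

open PowerSeries in
/-- The operator `y d/dy`, on coefficients. -/
lemma coeff_X_mul_derivative {R : Type*} [CommRing R] (f : PowerSeries R) (m : ℕ) :
    coeff m (X * derivative R f) = (m : R) * coeff m f := by
  cases m with
  | zero => simp
  | succ m =>
    rw [coeff_succ_X_mul, coeff_derivative]
    push_cast
    ring

open PowerSeries in
/-- The Airy-type recurrence on coefficients gives a second-order differential equation. -/
lemma ode_of_recurrence {R : Type*} [CommRing R] (f : PowerSeries R) (v : R)
    (h1 : coeff 1 f = 0) (h2 : coeff 2 f = 0)
    (h : ∀ k : ℕ, 8 * ((k : R) + 3) * coeff (k + 3) f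
      + v * (4 * (k : R) ^ 2 + 12 * k + 5) * coeff k f = 0) :
    8 * (X * derivative R f) + C v * X ^ 3 * (4 * (X * derivative R (X * derivative R f))
      + 12 * (X * derivative R f) + 5 * f) = 0 := by
  have key : ∀ (n : ℕ) (g : PowerSeries R) (m : ℕ),
      coeff m ((n : PowerSeries R) * g) = n * coeff m g := by
    intro n g m
    rw [← nsmul_eq_mul, map_nsmul, nsmul_eq_mul]
  have key4 := key 4
  have key5 := key 5
  have key8 := key 8
  have key12 := key 12
  push_cast at key4 key5 key8 key12
  ext m
  rw [map_add, mul_assoc (C v), coeff_C_mul, coeff_X_pow_mul', key8, coeff_X_mul_derivative,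
    map_zero]
  split_ifs with hm
  · obtain ⟨k, rfl⟩ := Nat.exists_eq_add_of_le' hm
    simp only [Nat.add_sub_cancel, map_add, key4, key5, key12, coeff_X_mul_derivative]
    have := h k
    push_cast
    linear_combination this
  · have : m = 0 ∨ m = 1 ∨ m = 2 := by omega
    rcases this with rfl | rfl | rfl <;> simp [h1, h2]

open PowerSeries in
/-- Solutions of the equations for `v` and `-v` have constant modified Wronskian. -/
lemma wronskian_eq_two {R : Type*} [Field R] [CharZero R] (f g : PowerSeries R) (v : R)
    (hf0 : coeff 0 f = 1) (hg0 : coeff 0 g = 1)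
    (hf : 8 * (X * derivative R f) + C v * X ^ 3 * (4 * (X * derivative R (X * derivative R f))
      + 12 * (X * derivative R f) + 5 * f) = 0)
    (hg : 8 * (X * derivative R g) + C (-v) * X ^ 3 *
      (4 * (X * derivative R (X * derivative R g)) + 12 * (X * derivative R g) + 5 * g) = 0) :
    2 * f * g + C v * X ^ 3 * (g * (X * derivative R f) - f * (X * derivative R g)) = 2 := by
  have hE : X * derivative R (2 * f * g
      + C v * X ^ 3 * (g * (X * derivative R f) - f * (X * derivative R g))) = 0 := by
    have h4 : (4 : PowerSeries R) ≠ 0 := by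
      intro h
      have := congrArg (coeff 0) h
      rw [← map_ofNat (C (R := R)) 4] at this
      simp at this
    apply mul_left_cancel₀ h4
    have h2 : derivative R (2 : PowerSeries R) = 0 := by
      have := (derivative R).map_natCast (A := PowerSeries R) 2
      simpa using this
    have hC : derivative R (C v : PowerSeries R) = 0 := derivative_C
    have hX : derivative R (X : PowerSeries R) = 1 := derivative_X
    rw [map_neg] at hg
    simp only [Derivation.leibniz, map_add, map_sub, smul_eq_mul, Derivation.leibniz_pow, h2, hC,
      hX, nsmul_eq_mul] at hf hg ⊢
    push_cast
    linear_combination g * hf + f * hg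
  ext m
  cases m with
  | zero =>
    simp only [coeff_zero_eq_constantCoeff] at hf0 hg0
    simp [hf0, hg0]
  | succ m =>
    have h := congrArg (coeff (m + 1)) hE
    rw [coeff_X_mul_derivative, map_zero] at h
    rcases mul_eq_zero.mp h with h | h
    · exact absurd h (Nat.cast_ne_zero.mpr m.succ_ne_zero)
    · rw [h, ← map_ofNat (C (R := R)) 2, coeff_C, if_neg m.succ_ne_zero]

lemma aQ_succ (n : ℕ) :
    24 * ((n : ℚ) + 1) * aQ (n + 1) = -((6 * n + 1) * (6 * n + 5)) * aQ n := by
  have h6 : 6 * (n + 1) = 6 * n + 1 + 1 + 1 + 1 + 1 + 1 := by ring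
  have h3 : 3 * (n + 1) = 3 * n + 1 + 1 + 1 := by ring
  have h2 : 2 * (n + 1) = 2 * n + 1 + 1 := by ring
  have p3 : ((3 * n).factorial : ℚ) ≠ 0 := by exact_mod_cast Nat.factorial_ne_zero _
  have p2 : ((2 * n).factorial : ℚ) ≠ 0 := by exact_mod_cast Nat.factorial_ne_zero _
  unfold aQ
  rw [h6, h3, h2]
  simp only [Nat.factorial_succ]
  push_cast
  have q1 : (2 * (n : ℚ) + 1) ≠ 0 := by positivity
  have q2 : (2 * (n : ℚ) + 1 + 1) ≠ 0 := by positivity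
  have q3 : (3 * (n : ℚ) + 1) ≠ 0 := by positivity
  have q4 : (3 * (n : ℚ) + 1 + 1) ≠ 0 := by positivity
  have q5 : (3 * (n : ℚ) + 1 + 1 + 1) ≠ 0 := by positivity
  field_simp
  ring

instance charZero_K : CharZero K :=
  charZero_of_injective_algebraMap (algebraMap ℂ K).injective

/-- The power series underlying `A`. -/
def psA : PowerSeries K :=
  PowerSeries.mk fun m => if 3 ∣ m then ((aQ (m / 3) : ℚ) : K) * u⁻¹ ^ (2 * (m / 3)) else 0

lemma A_eq_ofPowerSeries : A = HahnSeries.ofPowerSeries ℤ K psA := rfl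

lemma coeff_psA_recurrence (k : ℕ) :
    8 * ((k : K) + 3) * PowerSeries.coeff (k + 3) psA
      + u⁻¹ ^ 2 * (4 * (k : K) ^ 2 + 12 * k + 5) * PowerSeries.coeff k psA = 0 := by
  simp only [psA, PowerSeries.coeff_mk]
  by_cases hk : 3 ∣ k
  · obtain ⟨n, rfl⟩ := hk
    have e1 : (3 * n + 3) / 3 = n + 1 := by omega
    have e2 : 3 * n / 3 = n := by omega
    have hd : 3 ∣ 3 * n + 3 := by omega
    rw [if_pos hd, if_pos (dvd_mul_right 3 n), e1, e2]
    have h := congrArg (fun q : ℚ => (q : K)) (aQ_succ n)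
    push_cast at h ⊢
    rw [mul_add 2 n 1, pow_add]
    linear_combination u⁻¹ ^ (2 * n) * u⁻¹ ^ 2 * h
  · have hd : ¬ 3 ∣ k + 3 := by omega
    simp [hk, hd]

/-- The image of `psA` under `y ↦ -y`. -/
def psAneg : PowerSeries K := PowerSeries.rescale (-1 : K) psA

lemma psA_wronskian :
    2 * psA * psAneg + PowerSeries.C (u⁻¹ ^ 2) * PowerSeries.X ^ 3 *
      (psAneg * (PowerSeries.X * PowerSeries.derivative K psA)
        - psA * (PowerSeries.X * PowerSeries.derivative K psAneg)) = 2 := by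
  apply wronskian_eq_two
  · simp [psA, aQ]
  · simp [psAneg, psA, aQ]
  · exact ode_of_recurrence _ _ (by simp [psA]) (by simp [psA]) coeff_psA_recurrence
  · refine ode_of_recurrence _ _ (by simp [psAneg, psA]) (by simp [psAneg, psA]) fun k => ?_
    have h := coeff_psA_recurrence k
    simp only [psAneg, PowerSeries.coeff_rescale]
    rw [pow_add]
    linear_combination (-(-1) ^ k) * h

lemma coeff_ofPowerSeries_of_neg (f : PowerSeries K) {m : ℤ} (hm : m < 0) :
    (HahnSeries.ofPowerSeries ℤ K f).coeff m = 0 := by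
  rw [HahnSeries.ofPowerSeries_apply]
  apply HahnSeries.embDomain_of_notMem_range
  rintro ⟨n, hn⟩
  simp at hn
  omega

lemma coeff_ofPowerSeries_natCast (f : PowerSeries K) (n : ℕ) :
    (HahnSeries.ofPowerSeries ℤ K f).coeff (n : ℤ) = PowerSeries.coeff n f :=
  HahnSeries.ofPowerSeries_apply_coeff f n

lemma derivLS_ofPowerSeries (f : PowerSeries K) :
    derivLS (HahnSeries.ofPowerSeries ℤ K f)
      = HahnSeries.ofPowerSeries ℤ K (PowerSeries.derivative K f) := by
  ext m
  change ((m + 1 : ℤ) : K) * (HahnSeries.ofPowerSeries ℤ K f).coeff (m + 1) = _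
  rcases lt_or_ge m 0 with hm | hm
  · rw [coeff_ofPowerSeries_of_neg _ hm]
    rcases eq_or_ne m (-1) with rfl | h
    · simp
    · rw [coeff_ofPowerSeries_of_neg _ (by omega), mul_zero]
  · lift m to ℕ using hm
    rw [coeff_ofPowerSeries_natCast, PowerSeries.coeff_derivative,
      show ((m : ℤ) + 1) = ((m + 1 : ℕ) : ℤ) by push_cast; ring, coeff_ofPowerSeries_natCast]
    push_cast
    ring

lemma negSub_ofPowerSeries (f : PowerSeries K) :
    negSub (HahnSeries.ofPowerSeries ℤ K f)
      = HahnSeries.ofPowerSeries ℤ K (PowerSeries.rescale (-1 : K) f) := by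
  ext m
  change (-1 : K) ^ m * (HahnSeries.ofPowerSeries ℤ K f).coeff m = _
  rcases lt_or_ge m 0 with hm | hm
  · rw [coeff_ofPowerSeries_of_neg _ hm, coeff_ofPowerSeries_of_neg _ hm, mul_zero]
  · lift m to ℕ using hm
    rw [coeff_ofPowerSeries_natCast, coeff_ofPowerSeries_natCast, PowerSeries.coeff_rescale,
      zpow_natCast]

lemma ySh_natCast (n : ℕ) (f : PowerSeries K) :
    ySh n (HahnSeries.ofPowerSeries ℤ K f)
      = HahnSeries.ofPowerSeries ℤ K (PowerSeries.X ^ n * f) := by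
  rw [ySh, map_mul, HahnSeries.ofPowerSeries_X_pow]

lemma ySh_add (f g : LaurentSeries K) (k : ℤ) : ySh k (f + g) = ySh k f + ySh k g :=
  mul_add _ _ _

lemma ySh_ySh (k l : ℤ) (f : LaurentSeries K) : ySh k (ySh l f) = ySh (k + l) f := by
  rw [ySh, ySh, ySh, ← mul_assoc, HahnSeries.single_mul_single, one_mul]

lemma smul_ofPowerSeries (c : K) (f : PowerSeries K) :
    c • HahnSeries.ofPowerSeries ℤ K f = HahnSeries.ofPowerSeries ℤ K (PowerSeries.C c * f) := by
  rw [map_mul, HahnSeries.ofPowerSeries_C, HahnSeries.C_mul_eq_smul]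

/-- The power series underlying `y · S_y f`. -/
def psB (f : PowerSeries K) : PowerSeries K :=
  PowerSeries.C (u⁻¹ ^ 2) * PowerSeries.X ^ 3 * (PowerSeries.X * PowerSeries.derivative K f)
    + PowerSeries.C (1 / 2 * u⁻¹ ^ 2) * PowerSeries.X ^ 3 * f + f

lemma B_eq_ofPowerSeries : B = HahnSeries.ofPowerSeries ℤ K (psB psA) := by
  have h3 (f) : ySh 3 _ = _ := ySh_natCast 3 f
  have h2 (f) : ySh 2 _ = _ := ySh_natCast 2 f
  have h1 (f) : ySh 1 _ = _ := ySh_natCast 1 f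
  have h0 : ySh (1 + -1) A = A := by simp [ySh]
  rw [B, Sy, ySh_add, ySh_add, ySh_ySh, h0, A_eq_ofPowerSeries, derivLS_ofPowerSeries, h3, h2,
    smul_ofPowerSeries, smul_ofPowerSeries, h1, h1, ← map_add, ← map_add, psB]
  congr 1
  ring

lemma rescale_neg_one_psB :
    PowerSeries.rescale (-1 : K) (psB psA)
      = -(PowerSeries.C (u⁻¹ ^ 2) * PowerSeries.X ^ 3 *
          (PowerSeries.X * PowerSeries.derivative K psAneg))
        - PowerSeries.C (1 / 2 * u⁻¹ ^ 2) * PowerSeries.X ^ 3 * psAneg + psAneg := by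
  have hE : PowerSeries.rescale (-1 : K) (PowerSeries.X * PowerSeries.derivative K psA)
      = PowerSeries.X * PowerSeries.derivative K psAneg := by
    ext m
    rw [PowerSeries.coeff_rescale, coeff_X_mul_derivative, coeff_X_mul_derivative, psAneg,
      PowerSeries.coeff_rescale]
    ring
  have hX : PowerSeries.rescale (-1 : K) (PowerSeries.X ^ 3) = -PowerSeries.X ^ 3 := by
    rw [map_pow, PowerSeries.rescale_X, map_neg, map_one]
    ring
  have hC (c : K) : PowerSeries.rescale (-1 : K) (PowerSeries.C c) = PowerSeries.C c := by
    ext m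
    rw [PowerSeries.coeff_rescale, PowerSeries.coeff_C]
    split_ifs with h <;> simp [h]
  rw [psB, map_add, map_add, map_mul, hE, map_mul, map_mul, map_mul, hX, hC, hC, ← psAneg]
  ring

/-- The identity `A(y) B(-y) + A(-y) B(y) = 2`. -/
theorem stmt9 : A * negSub B + negSub A * B = 2 := by
  rw [B_eq_ofPowerSeries, A_eq_ofPowerSeries, negSub_ofPowerSeries, negSub_ofPowerSeries,
    ← psAneg, ← map_mul, ← map_mul, ← map_add, rescale_neg_one_psB]
  have h := congrArg (HahnSeries.ofPowerSeries ℤ K) psA_wronskian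
  rw [map_ofNat] at h
  rw [← h, psB]
  congr 1
  ring

end
end
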